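/- arXiv:2204.09253 — 2 statements merged into one kernel-verified Lean document; each statement's English description precedes it below -/
import Mathlib

section
/- For every 0 < m ≤ M there exist constants C₁ > 0 and C₂ > 0 depending only on m and M with the following property. Let X be a real Hilbert space, T > 0, I = (0,T), 1 ≤ p ≤ ∞, let a be an admissible bilinear form, j an admissible functional, f ∈ W^{1,p}(I;X*) with derivative ḟ, u_* ∈ X with a(u_*, v) + j(v) ≥ ⟨f(0), v⟩ for all v ∈ X, and let u be a solution of the quasistatic variational inequality with data (a, j, f, u_*) with derivative u̇. Then ‖u̇‖_{L^p(I;X)} ≤ C₁ ‖ḟ‖_{L^p(I;X*)} and sup_{t∈[0,T]} ‖u(t)‖ ≤ C₂ (‖u_*‖ + ∫₀ᵀ ‖ḟ(s)‖_{X*} ds). -/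
open MeasureTheory Set Filter
open scoped ENNReal NNReal Topology

noncomputable section

/-- `u : [0,T] → E` belongs to `W^{1,p}((0,T); E)` with derivative `du`:
`du` is strongly measurable on `(0,T)` with finite `L^p` norm, and
`u t = u 0 + ∫₀ᵗ du` (Bochner integral) for every `t ∈ [0,T]`. -/
def MemW1p {E : Type*} [NormedAddCommGroup E] [NormedSpace ℝ E]
    (T : ℝ) (p : ℝ≥0∞) (u du : ℝ → E) : Prop :=
  AEStronglyMeasurable du (volume.restrict (Ioo 0 T)) ∧
  eLpNorm du p (volume.restrict (Ioo 0 T)) < ⊤ ∧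
  ∀ t ∈ Icc (0 : ℝ) T, u t = u 0 + ∫ s in (0 : ℝ)..t, du s

/-- An admissible bilinear form on a Hilbert space `X`: symmetric, bilinear,
coercive with constant `m` and bounded with constant `M`. -/
def AdmissibleForm {X : Type*} [NormedAddCommGroup X] [InnerProductSpace ℝ X]
    (m M : ℝ) (a : X → X → ℝ) : Prop :=
  (∀ v w, a v w = a w v) ∧
  (∀ v w z, a (v + w) z = a v z + a w z) ∧
  (∀ (c : ℝ) (v w : X), a (c • v) w = c * a v w) ∧
  (∀ v, m * ‖v‖ ^ 2 ≤ a v v) ∧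
  (∀ v w, |a v w| ≤ M * ‖v‖ * ‖w‖)

/-- An admissible functional on `X`: nonnegative, convex, positively homogeneous
and Lipschitz continuous. -/
def AdmissibleJ {X : Type*} [NormedAddCommGroup X] [InnerProductSpace ℝ X]
    (j : X → ℝ) : Prop :=
  (∀ v, 0 ≤ j v) ∧ ConvexOn ℝ univ j ∧
  (∀ (c : ℝ) (v : X), j (c • v) = |c| * j v) ∧
  (∃ L : ℝ≥0, LipschitzWith L j)

/-- `u` (with derivative `du`) is a solution of the quasistatic variational
inequality with data `(a, j, f, ustar)`. -/
def IsQVISol {X : Type*} [NormedAddCommGroup X] [InnerProductSpace ℝ X]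
    (T : ℝ) (p : ℝ≥0∞) (a : X → X → ℝ) (j : X → ℝ)
    (f : ℝ → (X →L[ℝ] ℝ)) (ustar : X) (u du : ℝ → X) : Prop :=
  MemW1p T p u du ∧ u 0 = ustar ∧
  ∀ᵐ t ∂(volume.restrict (Ioo 0 T)), ∀ v : X,
    a (u t) (v - du t) + j v - j (du t) ≥ (f t) (v - du t)

universe u

/-- A derivative is nonnegative if `φ s ≤ φ t` for points `s` of a dense set near `t`. -/
lemma HasDerivAt.nonneg_of_dense_le {φ : ℝ → ℝ} {d t b : ℝ} (hbt : b < t) {S : Set ℝ}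
    (hS : Dense S) (hle : ∀ s ∈ S, s ∈ Ioo b t → φ s ≤ φ t) (hφ : HasDerivAt φ d t) : 0 ≤ d := by
  have hlim : Tendsto (slope φ t) (𝓝[<] t) (𝓝 d) :=
    hφ.tendsto_slope.mono_left (nhdsWithin_mono _ fun s hs => ne_of_lt hs)
  refine ge_of_tendsto_of_frequently hlim ?_
  intro h
  obtain ⟨l, hl, hsub⟩ := mem_nhdsLT_iff_exists_Ioo_subset.1 h
  obtain ⟨s, hs, hsI⟩ := hS.exists_between (max_lt hbt hl)
  obtain ⟨h1, h2⟩ := max_lt_iff.1 hsI.1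
  refine hsub ⟨h2, hsI.2⟩ ?_
  beta_reduce
  rw [slope_def_field]
  exact div_nonneg_of_nonpos (by linarith [hle s hs ⟨h1, hsI.2⟩]) (by linarith [hsI.2])

section MemW1p

variable {E : Type*} [NormedAddCommGroup E] [NormedSpace ℝ E] {T : ℝ} {p : ℝ≥0∞} {u du : ℝ → E}

lemma MemW1p.integrableOn (hp : 1 ≤ p) (h : MemW1p T p u du) :
    IntegrableOn du (Ioo 0 T) :=
  MemLp.integrable hp ⟨h.1, h.2.1⟩

lemma MemW1p.ae_hasDerivAt [CompleteSpace E] (hT : 0 < T) (hp : 1 ≤ p) (h : MemW1p T p u du) :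
    ∀ᵐ t ∂(volume.restrict (Ioo 0 T)), HasDerivAt u (du t) t := by
  have hint : IntervalIntegrable du volume 0 T :=
    (intervalIntegrable_iff_integrableOn_Ioo_of_le hT.le).2 (h.integrableOn hp)
  rw [ae_restrict_iff' measurableSet_Ioo]
  filter_upwards [hint.ae_hasDerivAt_integral] with t ht htI
  rw [uIcc_of_le hT.le] at ht
  refine ((ht (Ioo_subset_Icc_self htI) 0 ⟨le_rfl, hT.le⟩).const_add (u 0)).congr_of_eventuallyEq ?_
  filter_upwards [isOpen_Ioo.mem_nhds htI] with s hs using h.2.2 s (Ioo_subset_Icc_self hs)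

lemma MemW1p.norm_le (hp : 1 ≤ p) (h : MemW1p T p u du) {t : ℝ} (ht : t ∈ Icc 0 T) :
    ‖u t‖ ≤ ‖u 0‖ + ∫ s in Ioo (0 : ℝ) T, ‖du s‖ := by
  rw [h.2.2 t ht]
  refine (norm_add_le _ _).trans (add_le_add_right ?_ _)
  refine (intervalIntegral.norm_integral_le_integral_norm ht.1).trans ?_
  rw [intervalIntegral.integral_of_le ht.1, integral_Ioc_eq_integral_Ioo]
  exact setIntegral_mono_set (h.integrableOn hp).norm (ae_of_all _ fun _ => norm_nonneg _)
    (Ioo_subset_Ioo_right ht.2).eventuallyLE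

end MemW1p

section Form

variable {X : Type*} [NormedAddCommGroup X] [InnerProductSpace ℝ X] {m M : ℝ} {a : X → X → ℝ}

/-- An admissible form with its second argument fixed, as a continuous linear map. -/
def AdmissibleForm.toCLM (ha : AdmissibleForm m M a) (w : X) : X →L[ℝ] ℝ :=
  LinearMap.mkContinuous
    { toFun := fun v => a v w
      map_add' := fun v z => ha.2.1 v z w
      map_smul' := fun c v => ha.2.2.1 c v w } (M * ‖w‖)
    fun v => (ha.2.2.2.2 v w).trans_eq (by ring)

lemma AdmissibleForm.smul_right (ha : AdmissibleForm m M a) (c : ℝ) (v w : X) :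
    a v (c • w) = c * a v w := by
  rw [ha.1, ha.2.2.1, ha.1 w]

lemma AdmissibleJ.add_le {j : X → ℝ} (hj : AdmissibleJ j) (v w : X) : j (v + w) ≤ j v + j w := by
  have h := hj.2.1.2 (mem_univ ((2 : ℝ) • v)) (mem_univ ((2 : ℝ) • w))
    (show (0 : ℝ) ≤ 1 / 2 by norm_num) (show (0 : ℝ) ≤ 1 / 2 by norm_num) (by norm_num)
  rw [smul_smul, smul_smul, hj.2.2.1, hj.2.2.1] at h
  norm_num at h
  linarith

/-- The variational inequality splits into a stability condition and an energy identity. -/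
lemma AdmissibleForm.variationalInequality_split (ha : AdmissibleForm m M a) {j : X → ℝ}
    (hj : AdmissibleJ j) {x w : X} {l : X →L[ℝ] ℝ}
    (h : ∀ v : X, a x (v - w) + j v - j w ≥ l (v - w)) :
    (∀ v, l v - a x v ≤ j v) ∧ l w - a x w = j w := by
  refine ⟨fun v => ?_, ?_⟩
  · have h1 := h (w + v)
    rw [add_sub_cancel_left] at h1
    linarith [hj.add_le w v]
  · have h0 := h ((0 : ℝ) • w)
    have h2 := h ((2 : ℝ) • w)
    have e0 : (0 : ℝ) • w - w = (-1 : ℝ) • w := by module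
    have e2 : (2 : ℝ) • w - w = w := by module
    rw [e0, ha.smul_right, map_smul, hj.2.2.1, smul_eq_mul, abs_zero] at h0
    rw [e2, hj.2.2.1, abs_two] at h2
    linarith

/-- The derivative of a solution is pointwise controlled by the derivative of the load. -/
lemma IsQVISol.ae_norm_deriv_le [CompleteSpace X] (hm : 0 < m) (ha : AdmissibleForm m M a)
    {T : ℝ} (hT : 0 < T) {p : ℝ≥0∞} (hp : 1 ≤ p) {j : X → ℝ} (hj : AdmissibleJ j)
    {f df : ℝ → (X →L[ℝ] ℝ)} (hf : MemW1p T p f df) {ustar : X} {u du : ℝ → X}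
    (hu : IsQVISol T p a j f ustar u du) :
    ∀ᵐ t ∂(volume.restrict (Ioo 0 T)), ‖du t‖ ≤ m⁻¹ * ‖df t‖ := by
  have hsplit : ∀ᵐ t ∂(volume.restrict (Ioo 0 T)),
      (∀ v, f t v - a (u t) v ≤ j v) ∧ f t (du t) - a (u t) (du t) = j (du t) :=
    hu.2.2.mono fun t ht => ha.variationalInequality_split hj ht
  have hdense := Measure.dense_of_ae ((ae_restrict_iff' measurableSet_Ioo).1 hsplit)
  filter_upwards [hsplit, hu.1.ae_hasDerivAt hT hp, hf.ae_hasDerivAt hT hp,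
    ae_restrict_mem measurableSet_Ioo] with t ht hut hft htI
  have hφ : HasDerivAt (fun s => f s (du t) - a (u s) (du t))
      (df t (du t) - a (du t) (du t)) t := by
    have h1 := (ContinuousLinearMap.apply ℝ ℝ (du t)).hasFDerivAt.comp_hasDerivAt t hft
    have h2 := (ha.toCLM (du t)).hasFDerivAt.comp_hasDerivAt t hut
    exact h1.sub h2
  have hnn := hφ.nonneg_of_dense_le htI.1 hdense fun s hs hsI =>
    ((hs ⟨hsI.1, hsI.2.trans htI.2⟩).1 (du t)).trans_eq ht.2.symm
  have hbound := (le_abs_self _).trans ((df t).le_opNorm (du t))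
  have hcoer := ha.2.2.2.1 (du t)
  rw [inv_mul_eq_div, le_div_iff₀ hm]
  rcases (norm_nonneg (du t)).eq_or_lt with h0 | hpos
  · rw [← h0, zero_mul]
    exact norm_nonneg _
  · refine le_of_mul_le_mul_right ?_ hpos
    nlinarith

end Form

/-- A priori estimates for the solution, with constants depending only on `m` and `M`. -/
theorem solution_estimates (m M : ℝ) (hm : 0 < m) (hmM : m ≤ M) :
    ∃ C₁ C₂ : ℝ, 0 < C₁ ∧ 0 < C₂ ∧
      ∀ (X : Type u) [NormedAddCommGroup X] [InnerProductSpace ℝ X] [CompleteSpace X],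
      ∀ (T : ℝ), 0 < T → ∀ (p : ℝ≥0∞), 1 ≤ p →
      ∀ (a : X → X → ℝ), AdmissibleForm m M a →
      ∀ (j : X → ℝ), AdmissibleJ j →
      ∀ (f df : ℝ → (X →L[ℝ] ℝ)), MemW1p T p f df →
      ∀ (ustar : X), (∀ v : X, a ustar v + j v ≥ (f 0) v) →
      ∀ (u du : ℝ → X), IsQVISol T p a j f ustar u du →
        eLpNorm du p (volume.restrict (Ioo 0 T)) ≤
          ENNReal.ofReal C₁ * eLpNorm df p (volume.restrict (Ioo 0 T)) ∧
        ∀ t ∈ Icc (0 : ℝ) T,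
          ‖u t‖ ≤ C₂ * (‖ustar‖ + ∫ s in Ioo (0 : ℝ) T, ‖df s‖) := by
  refine ⟨m⁻¹, 1 + m⁻¹, by positivity, by positivity, ?_⟩
  intro X _ _ _ T hT p hp a ha j hj f df hf ustar _ u du hu
  have hae := hu.ae_norm_deriv_le hm ha hT hp hj hf
  refine ⟨eLpNorm_le_mul_eLpNorm_of_ae_le_mul hae p, fun t ht => ?_⟩
  have hle : ∫ s in Ioo (0 : ℝ) T, ‖du s‖ ≤ m⁻¹ * ∫ s in Ioo (0 : ℝ) T, ‖df s‖ := by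
    rw [← integral_const_mul]
    exact integral_mono_ae (hu.1.integrableOn hp).norm
      ((hf.integrableOn hp).norm.const_mul _) hae
  have hnorm := hu.1.norm_le hp ht
  rw [hu.2.1] at hnorm
  have h0 : 0 ≤ ∫ s in Ioo (0 : ℝ) T, ‖df s‖ := integral_nonneg fun _ => norm_nonneg _
  have h1 : 0 ≤ m⁻¹ * ‖ustar‖ := by positivity
  linarith
end
end

section
/- Let X be a separable real Hilbert space, T > 0, I = (0,T), 1 ≤ p ≤ ∞. Let 0 < m ≤ M, let a be an admissible bilinear form, j an admissible functional, f ∈ W^{1,p}(I;X*) with derivative ḟ, and let u ∈ W^{1,p}(I;X) with derivative u̇. Suppose that for every strongly measurable w : (0,T) → X with ∫₀ᵀ ‖w(s)‖ ds < ∞ one has ∫₀ᵀ a(u(s), w(s) − u̇(s)) ds + ∫₀ᵀ j(w(s)) ds − ∫₀ᵀ j(u̇(s)) ds ≥ ∫₀ᵀ ⟨f(s), w(s) − u̇(s)⟩ ds. Then for a.e. t ∈ I and every v ∈ X, a(u(t), v − u̇(t)) + j(v) − j(u̇(t)) ≥ ⟨f(t), v − u̇(t)⟩; that is, u is a solution of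 the quasistatic variational inequality with data (a, j, f, u(0)). -/
open MeasureTheory Set Filter
open scoped ENNReal NNReal Topology

noncomputable section

/-- Membership in `W^{1,p}` with `1 ≤ p` on a bounded interval gives an integrable derivative. -/
theorem MemW1p.integrable_deriv {E : Type*} [NormedAddCommGroup E] [NormedSpace ℝ E]
    {T : ℝ} {p : ℝ≥0∞} (hp : 1 ≤ p) {u du : ℝ → E} (h : MemW1p T p u du) :
    Integrable du (volume.restrict (Ioo 0 T)) :=
  MemLp.integrable hp ⟨h.1, h.2.1⟩

/-- Functions in `W^{1,p}` with `1 ≤ p` are continuous on the closed interval. -/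
theorem MemW1p.continuousOn {E : Type*} [NormedAddCommGroup E] [NormedSpace ℝ E]
    {T : ℝ} {p : ℝ≥0∞} (hp : 1 ≤ p) {u du : ℝ → E} (h : MemW1p T p u du) :
    ContinuousOn u (Icc 0 T) := by
  have hint : IntegrableOn du (Icc 0 T) :=
    (integrableOn_Icc_iff_integrableOn_Ioo).2 (h.integrable_deriv hp)
  have hcont : ContinuousOn (fun t => ∫ s in (0 : ℝ)..t, du s) (Icc 0 T) :=
    (intervalIntegral.continuousOn_primitive hint).congr fun t ht =>
      intervalIntegral.integral_of_le ht.1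
  exact (continuousOn_const.add hcont).congr h.2.2

/-- Pairing a continuous function on `[0,T]` with an integrable one through a continuous bilinear
map gives an integrable function. -/
theorem integrable_bilin_of_continuousOn {E F : Type*} [NormedAddCommGroup E] [NormedSpace ℝ E]
    [NormedAddCommGroup F] [NormedSpace ℝ F] (L : E →L[ℝ] F →L[ℝ] ℝ) {T : ℝ}
    {u : ℝ → E} (hu : ContinuousOn u (Icc 0 T))
    {w : ℝ → F} (hw : Integrable w (volume.restrict (Ioo 0 T))) :
    Integrable (fun s => L (u s) (w s)) (volume.restrict (Ioo 0 T)) := by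
  obtain ⟨C, hC⟩ := isCompact_Icc.exists_bound_of_continuousOn hu
  have hum : AEStronglyMeasurable u (volume.restrict (Ioo 0 T)) :=
    (hu.mono Ioo_subset_Icc_self).aestronglyMeasurable measurableSet_Ioo
  refine (hw.norm.const_mul (‖L‖ * C)).mono'
    (L.aestronglyMeasurable_comp₂ hum hw.aestronglyMeasurable) ?_
  filter_upwards [ae_restrict_mem measurableSet_Ioo] with s hs
  refine (L.le_opNorm₂ _ _).trans ?_
  gcongr
  exact hC s (Ioo_subset_Icc_self hs)

/-- An admissible form is a continuous bilinear map. -/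
theorem AdmissibleForm.exists_continuousLinearMap {X : Type*} [NormedAddCommGroup X]
    [InnerProductSpace ℝ X] {m M : ℝ} {a : X → X → ℝ} (ha : AdmissibleForm m M a) :
    ∃ B : X →L[ℝ] X →L[ℝ] ℝ, ∀ v w, B v w = a v w := by
  obtain ⟨hsymm, hadd, hsmul, -, hbound⟩ := ha
  refine ⟨LinearMap.mkContinuous₂ (LinearMap.mk₂ ℝ a hadd hsmul ?_ ?_) M hbound, fun v w => rfl⟩
  · intro v w z
    rw [hsymm, hadd, hsymm w, hsymm z]
  · intro c v w
    rw [hsymm, hsmul, hsymm w]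
    rfl

/-- An admissible functional maps integrable functions to integrable functions. -/
theorem AdmissibleJ.integrable_comp {X : Type*} [NormedAddCommGroup X] [InnerProductSpace ℝ X]
    {j : X → ℝ} (hj : AdmissibleJ j) {α : Type*} [MeasurableSpace α] {μ : Measure α}
    {w : α → X} (hw : Integrable w μ) : Integrable (fun s => j (w s)) μ := by
  obtain ⟨-, -, hsmul, L, hL⟩ := hj
  have h0 : j 0 = 0 := by simpa using hsmul 0 0
  exact memLp_one_iff_integrable.1 (hL.comp_memLp h0 (memLp_one_iff_integrable.2 hw))

/-- The "time-integral" form of the variational inequality implies the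
"a.e. t" form, i.e. yields a genuine solution. -/
theorem time_integral_form_implies_ae_form
    {X : Type*} [NormedAddCommGroup X] [InnerProductSpace ℝ X] [CompleteSpace X]
    [TopologicalSpace.SeparableSpace X]
    (T : ℝ) (hT : 0 < T) (p : ℝ≥0∞) (hp : 1 ≤ p)
    (m M : ℝ) (hm : 0 < m) (hmM : m ≤ M)
    (a : X → X → ℝ) (ha : AdmissibleForm m M a)
    (j : X → ℝ) (hj : AdmissibleJ j)
    (f df : ℝ → (X →L[ℝ] ℝ)) (hf : MemW1p T p f df)
    (u du : ℝ → X) (hu : MemW1p T p u du)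
    (hint : ∀ w : ℝ → X, Integrable w (volume.restrict (Ioo 0 T)) →
      (∫ s in Ioo (0 : ℝ) T, a (u s) (w s - du s)) +
        (∫ s in Ioo (0 : ℝ) T, j (w s)) - (∫ s in Ioo (0 : ℝ) T, j (du s)) ≥
      ∫ s in Ioo (0 : ℝ) T, (f s) (w s - du s)) :
    IsQVISol T p a j f (u 0) u du := by
  obtain ⟨B, hB⟩ := ha.exists_continuousLinearMap
  have hdu := hu.integrable_deriv hp
  have huc := hu.continuousOn hp
  have hfc := hf.continuousOn hp
  have hj_cont : Continuous j := hj.2.2.2.choose_spec.continuous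
  have ha_int : ∀ w : ℝ → X, Integrable w (volume.restrict (Ioo 0 T)) →
      Integrable (fun s => a (u s) (w s - du s)) (volume.restrict (Ioo 0 T)) := fun w hw => by
    simpa only [hB, Pi.sub_apply] using integrable_bilin_of_continuousOn B huc (hw.sub hdu)
  have hf_int : ∀ w : ℝ → X, Integrable w (volume.restrict (Ioo 0 T)) →
      Integrable (fun s => f s (w s - du s)) (volume.restrict (Ioo 0 T)) := fun w hw =>
    integrable_bilin_of_continuousOn (ContinuousLinearMap.id ℝ (X →L[ℝ] ℝ)) hfc (hw.sub hdu)
  let gap : (ℝ → X) → ℝ → ℝ := fun w s =>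
    a (u s) (w s - du s) + j (w s) - j (du s) - f s (w s - du s)
  have hgap_int : ∀ w : ℝ → X, Integrable w (volume.restrict (Ioo 0 T)) →
      Integrable (gap w) (volume.restrict (Ioo 0 T)) := fun w hw =>
    (((ha_int w hw).add (hj.integrable_comp hw)).sub (hj.integrable_comp hdu)).sub (hf_int w hw)
  have hgap_nonneg : ∀ w : ℝ → X, Integrable w (volume.restrict (Ioo 0 T)) →
      0 ≤ ∫ s in Ioo (0 : ℝ) T, gap w s := fun w hw => by
    have hsum := (ha_int w hw).add (hj.integrable_comp hw)
    have hdiff := hsum.sub (hj.integrable_comp hdu)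
    have hsplit := integral_sub' hdiff (hf_int w hw)
    rw [integral_sub' hsum (hj.integrable_comp hdu),
      integral_add' (ha_int w hw) (hj.integrable_comp hw)] at hsplit
    exact (sub_nonneg.2 (hint w hw)).trans_eq hsplit.symm
  have hconst : ∀ v : X, ∀ᵐ s ∂(volume.restrict (Ioo 0 T)), 0 ≤ gap (fun _ => v) s := by
    intro v
    refine ae_nonneg_of_forall_setIntegral_nonneg (hgap_int _ (integrable_const v)) ?_
    intro S hS _
    classical
    have hw : Integrable (S.piecewise (fun _ => v) du) (volume.restrict (Ioo 0 T)) :=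
      Integrable.piecewise hS (integrable_const v).integrableOn hdu.integrableOn
    have hind : gap (S.piecewise (fun _ => v) du) = S.indicator (gap fun _ => v) := by
      funext s
      by_cases hs : s ∈ S
      · simp [gap, hs]
      · simp [gap, hs, ← hB]
    have hnonneg := hgap_nonneg _ hw
    rwa [hind, integral_indicator hS] at hnonneg
  refine ⟨hu, rfl, ?_⟩
  have hdense := ae_all_iff.2 fun n => hconst (TopologicalSpace.denseSeq X n)
  filter_upwards [hdense] with t ht v
  have hclosed : IsClosed {v : X | 0 ≤ gap (fun _ => v) t} := by
    refine isClosed_le continuous_const ?_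
    simp only [gap, ← hB]
    fun_prop
  have hv : v ∈ {v : X | 0 ≤ gap (fun _ => v) t} :=
    hclosed.closure_subset_iff.2 (range_subset_iff.2 ht) (TopologicalSpace.denseRange_denseSeq X v)
  exact sub_nonneg.1 hv
end
end
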